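/- Let G be a simple graph on a vertex type V, let p : V → V → ℝ be the indicator probabilities of G (p x y = 1 if G.Adj x y and p x y = 0 otherwise), and let β be a real number with 0 < β < 1. Let u, v be distinct vertices with G.Reachable u v. Then a walk ρ from u to v in the complete graph ⊤ on V maximizes the MLH score (∏ over edges (x,y) of ρ of p x y) · β^(ρ.length) among all walks from u to v in ⊤ if and only if every edge of ρ is an edge of G and ρ.length = G.dist u v. (Theorem 1: the most likely handicapped path in the probabilistic graph induced by a discrete graph is exactly the shortest path of the discrete graph.) -/

import Mathlib

/-- The MLH score of a walk in the complete graph on `V`, with respect to edge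
probabilities `p` and transmission parameter `β`:
`(∏ over edges (x,y) of the walk, p x y) * β ^ length`. -/
def mlhScore {V : Type*} (p : V → V → ℝ) (β : ℝ) {u v : V}
    (ρ : (⊤ : SimpleGraph V).Walk u v) : ℝ :=
  (ρ.darts.map (fun d => p d.fst d.snd)).prod * β ^ ρ.length

/-- With indicator edge probabilities, a walk all of whose edges lie in `G` has score
`β ^ length`. -/
theorem mlhScore_eq_pow_of_edges_mem {V : Type*} {G : SimpleGraph V} {p : V → V → ℝ}
    (hp : ∀ x y, G.Adj x y → p x y = 1) (β : ℝ) {u v : V}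
    {ρ : (⊤ : SimpleGraph V).Walk u v} (hρ : ∀ e ∈ ρ.edges, e ∈ G.edgeSet) :
    mlhScore p β ρ = β ^ ρ.length := by
  have hprod : (ρ.darts.map (fun d => p d.fst d.snd)).prod = 1 := by
    refine List.prod_eq_one fun x hx => ?_
    obtain ⟨d, hd, rfl⟩ := List.mem_map.1 hx
    exact hp _ _ (hρ d.edge (List.mem_map_of_mem hd))
  rw [mlhScore, hprod, one_mul]

/-- If `p` vanishes on non-edges of `G`, every walk with nonzero score has all its edges
in `G`. -/
theorem edges_mem_of_mlhScore_ne_zero {V : Type*} {G : SimpleGraph V} {p : V → V → ℝ}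
    (hp : ∀ x y, ¬ G.Adj x y → p x y = 0) {β : ℝ} {u v : V}
    {ρ : (⊤ : SimpleGraph V).Walk u v} (hρ : mlhScore p β ρ ≠ 0) :
    ∀ e ∈ ρ.edges, e ∈ G.edgeSet := by
  intro e he
  obtain ⟨d, hd, rfl⟩ := List.mem_map.1 he
  by_contra hadj
  have hzero : p d.fst d.snd = 0 := hp _ _ hadj
  refine hρ ?_
  rw [mlhScore, List.prod_eq_zero (List.mem_map.2 ⟨d, hd, hzero⟩), zero_mul]

/-- A walk all of whose edges lie in `G` is at least as long as the distance in `G`. -/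
theorem dist_le_length_of_edges_mem {V : Type*} {G H : SimpleGraph V} {u v : V}
    {ρ : H.Walk u v} (hρ : ∀ e ∈ ρ.edges, e ∈ G.edgeSet) : G.dist u v ≤ ρ.length := by
  simpa using SimpleGraph.dist_le (ρ.transfer G hρ)

/-- Theorem 1: with indicator edge probabilities coming from a discrete graph `G`
and `0 < β < 1`, a walk from `u` to `v` in the complete graph maximizes the MLH
score iff all of its edges are edges of `G` and its length is the graph distance
`G.dist u v`. -/
theorem mlh_max_iff_shortest_in_discrete {V : Type*} (G : SimpleGraph V)
    [DecidableRel G.Adj] (p : V → V → ℝ)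
    (hp : ∀ x y, p x y = if G.Adj x y then (1 : ℝ) else 0)
    (β : ℝ) (hβ0 : 0 < β) (hβ1 : β < 1) (u v : V) (huv : u ≠ v)
    (h : G.Reachable u v) (ρ : (⊤ : SimpleGraph V).Walk u v) :
    (∀ q : (⊤ : SimpleGraph V).Walk u v, mlhScore p β q ≤ mlhScore p β ρ) ↔
      ((∀ e ∈ ρ.edges, e ∈ G.edgeSet) ∧ ρ.length = G.dist u v) := by
  have hone : ∀ x y, G.Adj x y → p x y = 1 := fun x y hxy => by rw [hp, if_pos hxy]
  have hzero : ∀ x y, ¬ G.Adj x y → p x y = 0 := fun x y hxy => by rw [hp, if_neg hxy]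
  constructor
  · intro hmax
    obtain ⟨w, hw⟩ := h.exists_walk_length_eq_dist
    have hle : β ^ G.dist u v ≤ mlhScore p β ρ := by
      have hedges : ∀ e ∈ (w.mapLe le_top).edges, e ∈ G.edgeSet := fun e he =>
        w.edges_subset_edgeSet (by simpa using he)
      simpa [mlhScore_eq_pow_of_edges_mem hone β hedges, hw] using hmax (w.mapLe le_top)
    have hρ := edges_mem_of_mlhScore_ne_zero hzero ((pow_pos hβ0 _).trans_le hle).ne'
    rw [mlhScore_eq_pow_of_edges_mem hone β hρ, pow_le_pow_iff_right_of_lt_one₀ hβ0 hβ1] at hle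
    exact ⟨hρ, hle.antisymm (dist_le_length_of_edges_mem hρ)⟩
  · rintro ⟨hρ, hlen⟩ q
    rw [mlhScore_eq_pow_of_edges_mem hone β hρ, hlen]
    by_cases hq : mlhScore p β q = 0
    · exact hq.le.trans (pow_pos hβ0 _).le
    · have hq' := edges_mem_of_mlhScore_ne_zero hzero hq
      rw [mlhScore_eq_pow_of_edges_mem hone β hq']
      exact pow_le_pow_of_le_one hβ0.le hβ1.le (dist_le_length_of_edges_mem hq')
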